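/- Let F be a finite field with q elements. Any two cyclic subgroups of order q² + q + 1 of the projective general linear group PGL(3, F) = GL(3, F)/Z (the quotient of GL(3,F) by its center) are conjugate in PGL(3, F): if G₁ and G₂ are subgroups of PGL(3,F) that are cyclic of cardinality q² + q + 1, then there exists g ∈ PGL(3, F) with G₂ = g G₁ g⁻¹. -/

import Mathlib

open Polynomial Matrix in
/-- Either a cubic polynomial relation of field type holds or `A` has order prime to the Singer
order. -/
lemma singer_dichotomy {F : Type*} [Field F] [Fintype F] (A : GL (Fin 3) F) :
    (∃ f : F[X], Irreducible f ∧ f.natDegree = 3 ∧ aeval (A : Matrix (Fin 3) (Fin 3) F) f = 0) ∨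
    (∃ N : ℕ, A ^ ((Fintype.card F ^ 2 - 1) * Fintype.card F ^ N) = 1) := by
  classical
  set q := Fintype.card F with hq
  have hq1 : 1 < q := Fintype.one_lt_card
  set M : Matrix (Fin 3) (Fin 3) F := A.val with hM
  have hdeg : M.charpoly.natDegree = 3 := by simp [Matrix.charpoly_natDegree_eq_dim]
  have hne : M.charpoly ≠ 0 := M.charpoly_monic.ne_zero
  by_cases h : ∃ f : F[X], Irreducible f ∧ f ∣ M.charpoly ∧ f.natDegree = 3
  · left
    obtain ⟨f, hf, hd, h3⟩ := h
    refine ⟨f, hf, h3, ?_⟩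
    have := associated_of_dvd_of_natDegree_le hd hne (by omega)
    obtain ⟨c, hc⟩ := this.symm.dvd
    rw [hc, map_mul, Matrix.aeval_self_charpoly, zero_mul]
  · right
    push Not at h
    have key : ∀ f : F[X], Irreducible f → f ∣ M.charpoly → f ∣ (X ^ q ^ 2 - X : F[X]) := by
      intro f hf hd
      have h1 := natDegree_le_of_dvd hd hne
      have h2 := h f hf hd
      have h3 := hf.natDegree_pos
      rw [hq, ← Nat.card_eq_fintype_card, ← hf.natDegree_dvd_iff_dvd_X_pow_card_pow_sub_X]
      have : f.natDegree = 1 ∨ f.natDegree = 2 := by omega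
      rcases this with h | h <;> simp [h]
    have key2 : ∃ n, M.charpoly ∣ (X ^ q ^ 2 - X : F[X]) ^ n := by
      have : ∀ p : F[X], p ≠ 0 → (∀ f : F[X], Irreducible f → f ∣ p → f ∣ (X ^ q ^ 2 - X : F[X])) →
          ∃ n, p ∣ (X ^ q ^ 2 - X : F[X]) ^ n := by
        intro p
        induction p using WfDvdMonoid.induction_on_irreducible with
        | zero => intro h; exact absurd rfl h
        | unit u hu => intro _ _; exact ⟨0, hu.dvd⟩
        | mul a i ha hi ih =>
          intro _ hh
          obtain ⟨n, hn⟩ := ih ha (fun f hf hd => hh f hf (hd.mul_left _))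
          refine ⟨n + 1, ?_⟩
          rw [pow_succ']
          exact mul_dvd_mul (hh i hi (dvd_mul_right _ _)) hn
      exact this _ hne key
    obtain ⟨n, c, hc⟩ := key2
    have hz : (M ^ q ^ 2 - M) ^ n = 0 := by
      have := congrArg (aeval M) hc
      simpa [Matrix.aeval_self_charpoly] using this
    obtain ⟨p, hp⟩ := CharP.exists F
    obtain ⟨k, hpp, hk⟩ := FiniteField.card F p
    have : Fact p.Prime := ⟨hpp⟩
    have hz2 : (M ^ (q ^ 2 - 1) - 1) ^ n = 0 := by
      have e : M ^ q ^ 2 - M = M * (M ^ (q ^ 2 - 1) - 1) := by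
        rw [mul_sub, ← pow_succ', Nat.sub_add_cancel (Nat.one_le_pow _ _ (by omega)), mul_one]
      have hcm : Commute M (M ^ (q ^ 2 - 1) - 1) :=
        ((Commute.refl M).pow_right _).sub_right (Commute.one_right _)
      rw [e, hcm.mul_pow] at hz
      have hu : IsUnit (M ^ n) := (A.isUnit).pow n
      exact hu.mul_right_eq_zero.1 hz
    refine ⟨n, ?_⟩
    have hle : n ≤ q ^ n := (Nat.lt_pow_self hq1).le
    have hz3 : (M ^ (q ^ 2 - 1) - 1) ^ q ^ n = 0 := pow_eq_zero_of_le hle hz2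
    have hqn : q ^ n = p ^ ((k : ℕ) * n) := by rw [hq, hk, pow_mul]
    rw [hqn, sub_pow_char_pow_of_commute _ _ (Commute.one_right _), one_pow, sub_eq_zero] at hz3
    ext1
    rw [hqn, pow_mul]
    simpa using hz3

open Matrix in
/-- The map from the units of a field `L` acting on `F³` to the projective group. -/
noncomputable def singerMap {F L : Type*} [Field F] [Field L] [Algebra F L]
    (φ : L →ₐ[F] Matrix (Fin 3) (Fin 3) F) :
    Lˣ →* (GL (Fin 3) F ⧸ Subgroup.center (GL (Fin 3) F)) :=
  (QuotientGroup.mk' _).comp (Units.map (φ : L →* Matrix (Fin 3) (Fin 3) F))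

lemma singer_arith (q N : ℕ) (hq : 1 < q) (h : q ^ 2 + q + 1 ∣ (q ^ 2 - 1) * q ^ N) : False := by
  have h1 : Nat.Coprime (q ^ 2 + q + 1) q := by
    have : q ^ 2 + q + 1 = 1 + q * (q + 1) := by ring
    rw [this]; simp
  have h2 : Nat.Coprime (q ^ 2 + q + 1) (q + 1) := by
    have : q ^ 2 + q + 1 = 1 + (q + 1) * q := by ring
    rw [this]; simp
  have h3 := (h1.pow_right N).dvd_of_dvd_mul_right h
  have h4 : q ^ 2 - 1 = (q + 1) * (q - 1) := by
    simpa using Nat.sq_sub_sq q 1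
  rw [h4] at h3
  have h5 := h2.dvd_of_dvd_mul_left h3
  have := Nat.le_of_dvd (by omega) h5
  nlinarith [Nat.sub_le q 1]

open Matrix in
lemma singer_skolem {F L : Type*} [Field F] [Field L] [Algebra F L]
    (hL : Module.finrank F L = 3) (φ₁ φ₂ : L →ₐ[F] Matrix (Fin 3) (Fin 3) F) :
    ∃ P : GL (Fin 3) F, ∀ x, P.val * φ₁ x = φ₂ x * P.val := by
  have fd : FiniteDimensional F L := Module.finite_of_finrank_pos (by omega)
  have mk : ∀ φ : L →ₐ[F] Matrix (Fin 3) (Fin 3) F,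
      ∃ e : L ≃ₗ[F] (Fin 3 → F), ∀ x y, e (x * y) = φ x *ᵥ e y := by
    intro φ
    let v : Fin 3 → F := Pi.single 0 1
    let e : L →ₗ[F] (Fin 3 → F) :=
      { toFun := fun x => φ x *ᵥ v
        map_add' := fun x y => by simp [add_mulVec]
        map_smul' := fun c x => by simp [smul_mulVec] }
    have hinj : Function.Injective e := by
      rw [injective_iff_map_eq_zero]
      intro x hx
      by_contra h0
      have h1 : φ x⁻¹ *ᵥ (φ x *ᵥ v) = 0 := by
        have : φ x *ᵥ v = 0 := hx
        rw [this, mulVec_zero]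
      rw [mulVec_mulVec, ← map_mul, inv_mul_cancel₀ h0, map_one, one_mulVec] at h1
      have := congrFun h1 0
      simp [v] at this
    have hsurj : Function.Surjective e :=
      (LinearMap.injective_iff_surjective_of_finrank_eq_finrank (by simp [hL])).1 hinj
    refine ⟨LinearEquiv.ofBijective e ⟨hinj, hsurj⟩, fun x y => ?_⟩
    change φ (x * y) *ᵥ v = φ x *ᵥ (φ y *ᵥ v)
    rw [mulVec_mulVec, map_mul]
  obtain ⟨e₁, h₁⟩ := mk φ₁
  obtain ⟨e₂, h₂⟩ := mk φ₂
  let T := e₁.symm.trans e₂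
  refine ⟨⟨LinearMap.toMatrix' T.toLinearMap, LinearMap.toMatrix' T.symm.toLinearMap, ?_, ?_⟩, ?_⟩
  · rw [← LinearMap.toMatrix'_comp]; simp
  · rw [← LinearMap.toMatrix'_comp]; simp
  · intro x
    apply Matrix.toLin'.injective
    ext1 i
    ext1
    simp only [LinearMap.comp_apply, Matrix.toLin'_mul, Matrix.toLin'_toMatrix']
    generalize LinearMap.single F (fun _ => F) i 1 = w
    obtain ⟨y, rfl⟩ := e₁.surjective w
    simp [T, ← h₁, ← h₂]

open Matrix in
lemma singer_eq_range {F L : Type*} [Field F] [Fintype F] [Field L] [Algebra F L]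
    (hL : Module.finrank F L = 3)
    (G : Subgroup (GL (Fin 3) F ⧸ Subgroup.center (GL (Fin 3) F)))
    (hcyc : IsCyclic G)
    (hcard : Nat.card G = Fintype.card F ^ 2 + Fintype.card F + 1) :
    ∃ φ : L →ₐ[F] Matrix (Fin 3) (Fin 3) F, (singerMap φ).range = G := by
  have hq1 : 1 < Fintype.card F := Fintype.one_lt_card
  have fd : FiniteDimensional F L := Module.finite_of_finrank_pos (by omega)
  have fL : Finite L := Module.finite_of_finite F
  obtain ⟨g, hg⟩ := (Subgroup.isCyclic_iff_exists_zpowers_eq_top G).1 hcyc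
  obtain ⟨A, rfl⟩ := QuotientGroup.mk_surjective g
  rcases singer_dichotomy A with ⟨f, hf, h3, hA⟩ | ⟨N, hN⟩
  · have : Fact (Irreducible f) := ⟨hf⟩
    have hfin : Module.finrank F (AdjoinRoot f) = 3 := by
      rw [(AdjoinRoot.powerBasis hf.ne_zero).finrank, AdjoinRoot.powerBasis_dim, h3]
    have fd' : FiniteDimensional F (AdjoinRoot f) := Module.finite_of_finrank_pos (by omega)
    have fL' : Finite (AdjoinRoot f) := Module.finite_of_finite F
    obtain ⟨p, hp⟩ := CharP.exists F
    obtain ⟨k, hpp, hk⟩ := FiniteField.card F p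
    have : Fact p.Prime := ⟨hpp⟩
    let e : L ≃ₐ[F] AdjoinRoot f :=
      (FiniteField.algEquivExtension F p 3 L hL).trans
        (FiniteField.algEquivExtension F p 3 (AdjoinRoot f) hfin).symm
    let lf : AdjoinRoot f →ₐ[F] Matrix (Fin 3) (Fin 3) F := Ideal.Quotient.liftₐ _
      (Polynomial.aeval A.val) (by
        intro a ha
        obtain ⟨c, rfl⟩ := Ideal.mem_span_singleton.1 ha
        rw [map_mul, hA, zero_mul])
    have hlf : lf (AdjoinRoot.root f) = A.val := by
      have : lf (AdjoinRoot.mk f Polynomial.X) = Polynomial.aeval A.val Polynomial.X := rfl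
      simpa using this
    let φ : L →ₐ[F] Matrix (Fin 3) (Fin 3) F := lf.comp e.toAlgHom
    refine ⟨φ, ?_⟩
    symm
    have hle : G ≤ (singerMap φ).range := by
      rw [← hg, Subgroup.zpowers_le]
      have hr : e.symm (AdjoinRoot.root f) ≠ 0 := by
        intro h0
        have h1 : φ (e.symm (AdjoinRoot.root f)) = A.val := by simp [φ, hlf]
        rw [h0, map_zero] at h1
        exact A.ne_zero h1.symm
      refine ⟨Units.mk0 _ hr, ?_⟩
      simp only [singerMap, MonoidHom.comp_apply, QuotientGroup.mk'_apply]
      congr 1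
      ext1
      simp [φ, hlf]
    refine Subgroup.eq_of_le_of_card_ge hle ?_
    rw [hcard]
    have hkc : Fintype.card F - 1 ≤ Nat.card (singerMap φ).ker := by
      have hsub : (Units.map (algebraMap F L : F →* L)).range ≤ (singerMap φ).ker := by
        rintro _ ⟨u, rfl⟩
        rw [MonoidHom.mem_ker]
        simp only [singerMap, MonoidHom.comp_apply, QuotientGroup.mk'_apply]
        rw [QuotientGroup.eq_one_iff,
          Matrix.GeneralLinearGroup.mem_center_iff_val_mem_range_scalar]
        refine ⟨u, ?_⟩
        simp [Matrix.algebraMap_eq_diagonal]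
      have h1 := Subgroup.card_le_of_le hsub
      have hi : Function.Injective (Units.map (algebraMap F L : F →* L)) :=
        Units.map_injective (algebraMap F L).injective
      rw [← Nat.card_congr (MonoidHom.ofInjective hi).toEquiv, Nat.card_units,
        Nat.card_eq_fintype_card] at h1
      exact h1
    have hmul : Nat.card (singerMap φ).ker * Nat.card (singerMap φ).range
        = Fintype.card F ^ 3 - 1 := by
      rw [← Subgroup.index_ker, Subgroup.card_mul_index, Nat.card_units,
        Module.natCard_eq_pow_finrank (K := F) (V := L), hL, Nat.card_eq_fintype_card]
    obtain ⟨r, hr⟩ := Nat.exists_eq_add_of_lt hq1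
    have e3 : Fintype.card F ^ 3 - 1
        = (Fintype.card F - 1) * (Fintype.card F ^ 2 + Fintype.card F + 1) := by
      have : 1 ≤ Fintype.card F ^ 3 := Nat.one_le_pow _ _ (by omega)
      zify [this, hq1.le]
      ring
    by_contra hlt
    push Not at hlt
    have h5 : (Fintype.card F - 1) * (Fintype.card F ^ 2 + Fintype.card F + 1)
        < Nat.card (singerMap φ).ker * Nat.card (singerMap φ).range := by
      refine (Nat.mul_lt_mul_of_pos_left hlt (by omega)).trans_le (Nat.mul_le_mul_right _ hkc)
    omega
  · exfalso
    have h1 : orderOf (QuotientGroup.mk A : GL (Fin 3) F ⧸ Subgroup.center (GL (Fin 3) F))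
        = Fintype.card F ^ 2 + Fintype.card F + 1 := by
      rw [← hcard, ← hg, Nat.card_zpowers]
    refine singer_arith _ N hq1 (h1 ▸ orderOf_dvd_of_pow_eq_one ?_)
    rw [← QuotientGroup.mk_pow, hN, QuotientGroup.mk_one]


/-- All cyclic subgroups of order `q² + q + 1` of `PGL(3, F)`
(`F` a finite field with `q` elements) are conjugate: cyclic Singer groups of `PG(2, q)`
form a single conjugacy class. -/
theorem singer_groups_conjugate (q : ℕ) (F : Type*) [Field F] [Fintype F]
    (hF : Fintype.card F = q)
    (G₁ G₂ : Subgroup (Matrix.GeneralLinearGroup (Fin 3) F ⧸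
      Subgroup.center (Matrix.GeneralLinearGroup (Fin 3) F)))
    (h₁cyc : IsCyclic G₁) (h₂cyc : IsCyclic G₂)
    (h₁card : Nat.card G₁ = q ^ 2 + q + 1) (h₂card : Nat.card G₂ = q ^ 2 + q + 1) :
    ∃ g : Matrix.GeneralLinearGroup (Fin 3) F ⧸
      Subgroup.center (Matrix.GeneralLinearGroup (Fin 3) F),
      Subgroup.map (MulAut.conj g).toMonoidHom G₁ = G₂ := by
  subst hF
  obtain ⟨p, hp⟩ := CharP.exists F
  obtain ⟨k, hpp, hk⟩ := FiniteField.card F p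
  have : Fact p.Prime := ⟨hpp⟩
  have hL : Module.finrank F (FiniteField.Extension F p 3) = 3 :=
    FiniteField.finrank_extension F p 3
  obtain ⟨φ₁, rfl⟩ := singer_eq_range hL G₁ h₁cyc h₁card
  obtain ⟨φ₂, rfl⟩ := singer_eq_range hL G₂ h₂cyc h₂card
  obtain ⟨P, hP⟩ := singer_skolem hL φ₁ φ₂
  refine ⟨QuotientGroup.mk P, ?_⟩
  rw [← MonoidHom.range_comp]
  congr 1
  ext u
  have : P * Units.map (φ₁ : _ →* Matrix (Fin 3) (Fin 3) F) u * P⁻¹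
      = Units.map (φ₂ : _ →* Matrix (Fin 3) (Fin 3) F) u := by
    rw [mul_inv_eq_iff_eq_mul]
    ext1
    exact hP u
  simp only [singerMap, MonoidHom.comp_apply, QuotientGroup.mk'_apply, ← this]
  rfl
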